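/- arXiv:2211.02778 — 4 statements merged into one kernel-verified Lean document; each statement's English description precedes it below -/
import Mathlib

section
/- Combinatorial core of the CPoP optimality proof. Let d ∈ ℕ, p : {1,…,d} → [0,1], N > 0 and λ ≥ 0, and let p_(1) ≤ ⋯ ≤ p_(d) be the values p_1,…,p_d sorted increasingly. Then for every subset S ⊆ {1,…,d}, |S|/N − (1/N + λ/max(|S|,1))·Σ_{j∈S} p_j ≤ max_{K ∈ {0,1,…,d}} [ K/N − (1/N + λ/max(K,1))·Σ_{j=1}^K p_(j) ], and this maximum is attained by some subset S consisting of K indices whose p-values are the K smallest (for a maximizing K). In particular, the maximum of the left-hand side over all subsets of {1,…,d} equals the displayed maximum over K. -/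
/-- The sum of the `K` smallest values among `p 1, …, p d`
(the first `K` entries of the increasing rearrangement of `p`). -/
noncomputable def sumSmallest {d : ℕ} (p : Fin d → ℝ) (K : ℕ) : ℝ :=
  ∑ j ∈ Finset.univ.filter (fun j : Fin d => (j : ℕ) < K), p (Tuple.sort p j)

/-- A set whose `p`-values are all at most those of its complement minimizes the sum of `p`
among the sets of the same cardinality. -/
theorem Finset.sum_le_sum_of_forall_le_compl {ι : Type*} [DecidableEq ι] {p : ι → ℝ}
    {S T : Finset ι} (hT : ∀ j ∈ T, ∀ j' ∉ T, p j ≤ p j') (hcard : S.card = T.card) :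
    ∑ j ∈ T, p j ≤ ∑ j ∈ S, p j := by
  have hsdiff : (T \ S).card = (S \ T).card := Finset.card_sdiff_comm hcard.symm
  have hle : ∑ j ∈ T \ S, p j ≤ ∑ j ∈ S \ T, p j := by
    rcases (T \ S).eq_empty_or_nonempty with h | h
    · have h' : S \ T = ∅ := by rw [← Finset.card_eq_zero, ← hsdiff, h, Finset.card_empty]
      rw [h, h']
    · calc ∑ j ∈ T \ S, p j ≤ (T \ S).card • (T \ S).sup' h p :=
            Finset.sum_le_card_nsmul _ _ _ fun j hj => Finset.le_sup' p hj
        _ = (S \ T).card • (T \ S).sup' h p := by rw [hsdiff]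
        _ ≤ ∑ j ∈ S \ T, p j := Finset.card_nsmul_le_sum _ _ _ fun j' hj' =>
            Finset.sup'_le h p fun j hj =>
              hT j (Finset.mem_sdiff.1 hj).1 j' (Finset.mem_sdiff.1 hj').2
  rw [← Finset.sum_inter_add_sum_sdiff T S, ← Finset.sum_inter_add_sum_sdiff S T,
    Finset.inter_comm S T]
  gcongr

/-- For `K ≤ d` there is a set of `K` indices carrying the `K` smallest values of `p`. -/
theorem exists_card_eq_sum_eq_sumSmallest {d : ℕ} (p : Fin d → ℝ) {K : ℕ} (hK : K ≤ d) :
    ∃ T : Finset (Fin d), T.card = K ∧ (∀ j ∈ T, ∀ j' ∉ T, p j ≤ p j') ∧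
      ∑ j ∈ T, p j = sumSmallest p K := by
  refine ⟨(Finset.univ.filter fun j : Fin d => (j : ℕ) < K).map (Tuple.sort p).toEmbedding,
    ?_, ?_, ?_⟩
  · rw [Finset.card_map, Fin.card_filter_val_lt, min_eq_right hK]
  · intro j hj j' hj'
    obtain ⟨i, rfl⟩ := (Tuple.sort p).surjective j
    obtain ⟨i', rfl⟩ := (Tuple.sort p).surjective j'
    simp only [Finset.mem_map_equiv, Equiv.symm_apply_apply, Finset.mem_filter, Finset.mem_univ,
      true_and, not_lt] at hj hj'
    exact Tuple.monotone_sort p (Fin.le_def.2 (hj.le.trans hj'))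
  · simp [sumSmallest, Finset.sum_map]

/-- The sum of the `|S|` smallest values of `p` is at most the sum of `p` over `S`. -/
theorem sumSmallest_card_le_sum {d : ℕ} (p : Fin d → ℝ) (S : Finset (Fin d)) :
    sumSmallest p S.card ≤ ∑ j ∈ S, p j := by
  obtain ⟨T, hcard, hT, hsum⟩ := exists_card_eq_sum_eq_sumSmallest p (card_finset_fin_le S)
  exact hsum ▸ Finset.sum_le_sum_of_forall_le_compl hT hcard.symm

/-- **Combinatorial core of the CPoP optimality proof.** For every subset `S` of
`{1,…,d}`, the quantity `|S|/N − (1/N + λ/max(|S|,1))·Σ_{j∈S} p j` is at most the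
maximum over `K ∈ {0,…,d}` of `K/N − (1/N + λ/max(K,1))·(sum of K smallest p's)`;
this maximum is attained by a subset of `K` indices whose `p`-values are the `K`
smallest; in particular the maximum over all subsets equals the displayed maximum. -/
theorem cpop_combinatorial_core
    (d : ℕ) (p : Fin d → ℝ) (hp : ∀ j, p j ∈ Set.Icc (0 : ℝ) 1)
    (N lam : ℝ) (hN : 0 < N) (hlam : 0 ≤ lam) :
    (∀ S : Finset (Fin d),
      (S.card : ℝ) / N - (1 / N + lam / max (S.card : ℝ) 1) * ∑ j ∈ S, p j ≤
        (Finset.range (d + 1)).sup' (by simp) (fun K =>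
          (K : ℝ) / N - (1 / N + lam / max (K : ℝ) 1) * sumSmallest p K)) ∧
    (∃ K ∈ Finset.range (d + 1), ∃ S : Finset (Fin d), S.card = K ∧
      (∀ j ∈ S, ∀ j' ∉ S, p j ≤ p j') ∧
      (S.card : ℝ) / N - (1 / N + lam / max (S.card : ℝ) 1) * ∑ j ∈ S, p j =
        (Finset.range (d + 1)).sup' (by simp) (fun K =>
          (K : ℝ) / N - (1 / N + lam / max (K : ℝ) 1) * sumSmallest p K)) ∧
    ((Finset.univ : Finset (Fin d)).powerset.sup' (Finset.powerset_nonempty _)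
        (fun S => (S.card : ℝ) / N - (1 / N + lam / max (S.card : ℝ) 1) * ∑ j ∈ S, p j) =
      (Finset.range (d + 1)).sup' (by simp) (fun K =>
        (K : ℝ) / N - (1 / N + lam / max (K : ℝ) 1) * sumSmallest p K)) := by
  have hbound : ∀ S : Finset (Fin d),
      (S.card : ℝ) / N - (1 / N + lam / max (S.card : ℝ) 1) * ∑ j ∈ S, p j ≤
        (Finset.range (d + 1)).sup' (by simp) (fun K =>
          (K : ℝ) / N - (1 / N + lam / max (K : ℝ) 1) * sumSmallest p K) := by
    intro S
    have hS : S.card ∈ Finset.range (d + 1) :=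
      Finset.mem_range.2 (Nat.lt_succ_of_le (card_finset_fin_le S))
    refine le_trans ?_ (Finset.le_sup' (fun K : ℕ =>
      (K : ℝ) / N - (1 / N + lam / max (K : ℝ) 1) * sumSmallest p K) hS)
    have hcoef : 0 ≤ 1 / N + lam / max (S.card : ℝ) 1 := by positivity
    exact sub_le_sub_left (mul_le_mul_of_nonneg_left (sumSmallest_card_le_sum p S) hcoef) _
  obtain ⟨K, hK, hmax⟩ := Finset.exists_mem_eq_sup' (s := Finset.range (d + 1)) (by simp)
    (fun K : ℕ => (K : ℝ) / N - (1 / N + lam / max (K : ℝ) 1) * sumSmallest p K)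
  obtain ⟨T, hcard, hT, hsum⟩ :=
    exists_card_eq_sum_eq_sumSmallest p (Nat.le_of_lt_succ (Finset.mem_range.1 hK))
  have hattain : (T.card : ℝ) / N - (1 / N + lam / max (T.card : ℝ) 1) * ∑ j ∈ T, p j =
      (Finset.range (d + 1)).sup' (by simp) (fun K =>
        (K : ℝ) / N - (1 / N + lam / max (K : ℝ) 1) * sumSmallest p K) := by
    rw [hmax, hcard, hsum]
  refine ⟨hbound, ⟨K, hK, T, hcard, hT, hattain⟩,
    le_antisymm (Finset.sup'_le _ _ fun S _ => hbound S) ?_⟩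
  rw [← hattain]
  exact Finset.le_sup' (fun S : Finset (Fin d) =>
    (S.card : ℝ) / N - (1 / N + lam / max (S.card : ℝ) 1) * ∑ j ∈ S, p j)
    (Finset.mem_powerset.2 T.subset_univ)
end

section
/- Continuity of the BFDR of CPoP in its parameter (intermediate claim in the proof of Proposition 2). Assume the law of the random vector (P_1, …, P_d) (the pushforward of μ under ω ↦ (P_1(ω),…,P_d(ω))) is absolutely continuous with respect to Lebesgue measure on ℝ^d. Then the map λ ↦ BFDR(C_P(λ)) is continuous on (0,∞). -/
open MeasureTheory

variable {Ω : Type*}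

/-- The CPoP objective `K − (1 − λN/max(K,1))·Σ_{j=1}^K p_(j)`. -/
noncomputable def cpopObj (N lam : ℝ) {d : ℕ} (p : Fin d → ℝ) (K : ℕ) : ℝ :=
  (K : ℝ) - (1 - lam * N / max (K : ℝ) 1) * sumSmallest p K

/-- The false discovery proportion `FD(T)/max(R(T),1)`. -/
noncomputable def FDP {d : ℕ} (A T : Fin d → Set Ω) (ω : Ω) : ℝ :=
  (∑ j, (T j ∩ A j).indicator (fun _ => (1 : ℝ)) ω) /
    max (∑ j, (T j).indicator (fun _ => (1 : ℝ)) ω) 1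

/-- The Bayesian FDR `E[FD(T)/max(R(T),1)]`. -/
noncomputable def BFDR {_m : MeasurableSpace Ω} (μ : Measure Ω) {d : ℕ}
    (A T : Fin d → Set Ω) : ℝ :=
  ∫ ω, FDP A T ω ∂μ

theorem ae_sum_mul_ne {ι : Type*} [Fintype ι] (c : ι → ℝ) {b : ℝ} (hb : b ≠ 0) :
    ∀ᵐ p ∂(volume : Measure (ι → ℝ)), ∑ j, c j * p j ≠ b := by
  let s : AffineSubspace ℝ (ι → ℝ) :=
    { carrier := {p | ∑ j, c j * p j = b}
      smul_vsub_vadd_mem' := by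
        intro t p q r hp hq hr
        simp only [Set.mem_setOf_eq, vsub_eq_sub, vadd_eq_add, Pi.add_apply, Pi.smul_apply,
          Pi.sub_apply, smul_eq_mul] at *
        have h : ∀ j, c j * (t * (p j - q j) + r j)
            = t * (c j * p j) - t * (c j * q j) + c j * r j := fun j => by ring
        simp only [h, Finset.sum_add_distrib, Finset.sum_sub_distrib, ← Finset.mul_sum, hp, hq, hr]
        ring }
  have hs : s ≠ ⊤ := by
    intro h
    have h0 : (0 : ι → ℝ) ∈ s := h ▸ AffineSubspace.mem_top ℝ _ _
    have h0' : ∑ j, c j * (0 : ι → ℝ) j = b := h0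
    exact hb (by simpa using h0'.symm)
  have h := Measure.addHaar_affineSubspace (volume : Measure (ι → ℝ)) s hs
  rw [ae_iff]
  simp only [ne_eq, not_not]
  exact h

theorem ae_injective {ι : Type*} [Fintype ι] :
    ∀ᵐ p ∂(volume : Measure (ι → ℝ)), Function.Injective p := by
  classical
  have h : ∀ i j : ι, i ≠ j → ∀ᵐ p ∂(volume : Measure (ι → ℝ)), p i ≠ p j := by
    intro i j hij
    let s : Submodule ℝ (ι → ℝ) :=
      LinearMap.ker (LinearMap.proj (R := ℝ) (φ := fun _ : ι => ℝ) i - LinearMap.proj j)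
    have hs : s ≠ ⊤ := by
      intro h
      have h1 : Pi.single i (1 : ℝ) ∈ s := h ▸ Submodule.mem_top
      simp [s, LinearMap.mem_ker, Pi.single_eq_of_ne hij.symm] at h1
    have h := Measure.addHaar_submodule (volume : Measure (ι → ℝ)) s hs
    rw [ae_iff]
    convert h using 2
    ext p
    simp [s, LinearMap.mem_ker, sub_eq_zero]
  have h' : ∀ᵐ p ∂(volume : Measure (ι → ℝ)), ∀ i j : ι, i ≠ j → p i ≠ p j := by
    rw [ae_all_iff]; intro i
    rw [ae_all_iff]; intro j
    by_cases hij : i = j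
    · simp [hij]
    · filter_upwards [h i j hij] with p hp _ using hp
  filter_upwards [h'] with p hp i j hij
  by_contra hne
  exact hp i j hne hij

/-- For almost every `p`, the CPoP objective takes distinct values at distinct `K`. -/
theorem ae_cpopObj_injective (N lam : ℝ) (d : ℕ) :
    ∀ᵐ p ∂(volume : Measure (Fin d → ℝ)), Function.Injective (cpopObj N lam p) := by
  have h : ∀ᵐ p ∂(volume : Measure (Fin d → ℝ)), ∀ (σ : Equiv.Perm (Fin d)) (K L : ℕ), K ≠ L →
      (∑ j, ((1 - lam * N / max (K : ℝ) 1) * (if (σ.symm j : ℕ) < K then 1 else 0) -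
        (1 - lam * N / max (L : ℝ) 1) * (if (σ.symm j : ℕ) < L then 1 else 0)) * p j)
        ≠ (K : ℝ) - L := by
    refine ae_all_iff.2 fun σ => ae_all_iff.2 fun K => ae_all_iff.2 fun L => ?_
    by_cases hKL : K = L
    · simp [hKL]
    · filter_upwards [ae_sum_mul_ne _ (sub_ne_zero.2 (Nat.cast_injective.ne hKL))] with p hp _
      exact hp
  have hsum : ∀ (p : Fin d → ℝ) (K : ℕ), sumSmallest p K =
      ∑ j, (if ((Tuple.sort p).symm j : ℕ) < K then 1 else 0) * p j := by
    intro p K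
    conv_rhs => rw [← Equiv.sum_comp (Tuple.sort p)]
    rw [sumSmallest, Finset.sum_filter]
    simp
  filter_upwards [h] with p hp K L hKL
  by_contra hne
  refine hp (Tuple.sort p) K L hne ?_
  simp only [cpopObj] at hKL
  simp only [sub_mul, mul_assoc, Finset.sum_sub_distrib, ← Finset.mul_sum, ← hsum]
  linarith

theorem Set.eq_of_ncard_eq_of_forall_le {ι α : Type*} [Finite ι] [PartialOrder α] {p : ι → α}
    (hp : Function.Injective p) {S T : Set ι} (hcard : S.ncard = T.ncard)
    (hS : ∀ i j, i ∈ S → j ∉ S → p i ≤ p j) (hT : ∀ i j, i ∈ T → j ∉ T → p i ≤ p j) :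
    S = T := by
  by_cases h : S ⊆ T
  · exact Set.eq_of_subset_of_ncard_le h hcard.ge
  · obtain ⟨i, hiS, hiT⟩ := Set.not_subset.1 h
    refine (Set.eq_of_subset_of_ncard_le (fun j hjT => ?_) hcard.le).symm
    by_contra hjS
    have hij := hp (le_antisymm (hS i j hiS hjS) (hT j i hjT hiT))
    exact hiT (hij ▸ hjT)

theorem eventually_eq_of_forall_cpopObj_le {N lam₀ : ℝ} {d : ℕ} {p : Fin d → ℝ}
    (hinj : Function.Injective (cpopObj N lam₀ p)) {K : ℝ → ℕ} (hle : ∀ lam, K lam ≤ d)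
    (hmax : ∀ᶠ lam in nhds lam₀, ∀ L ≤ d, cpopObj N lam p L ≤ cpopObj N lam p (K lam)) :
    ∀ᶠ lam in nhds lam₀, K lam = K lam₀ := by
  have hlt : ∀ᶠ lam in nhds lam₀, ∀ L ∈ Finset.range (d + 1), L ≠ K lam₀ →
      cpopObj N lam p L < cpopObj N lam p (K lam₀) := by
    rw [Filter.eventually_all_finset]
    intro L hL
    by_cases hLK : L = K lam₀
    · simp [hLK]
    · have hcont : ∀ M : ℕ, Continuous fun lam => cpopObj N lam p M := by
        intro M
        unfold cpopObj
        fun_prop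
      have h0 : cpopObj N lam₀ p L < cpopObj N lam₀ p (K lam₀) :=
        lt_of_le_of_ne (hmax.self_of_nhds L (Nat.lt_succ_iff.1 (Finset.mem_range.1 hL)))
          (hinj.ne hLK)
      filter_upwards [(hcont L).continuousAt.eventually_lt (hcont _).continuousAt h0] with lam h _
      exact h
  filter_upwards [hlt, hmax] with lam h1 h2
  by_contra hne
  exact (h1 _ (Finset.mem_range.2 (Nat.lt_succ_of_le (hle lam))) hne).not_ge (h2 _ (hle lam₀))

theorem measurable_FDP {mΩ : MeasurableSpace Ω} {d : ℕ} {A T : Fin d → Set Ω}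
    (hA : ∀ j, MeasurableSet (A j)) (hT : ∀ j, MeasurableSet (T j)) : Measurable (FDP A T) := by
  unfold FDP
  exact (Finset.measurable_fun_sum _ fun j _ => measurable_const.indicator ((hT j).inter (hA j))).div
    ((Finset.measurable_fun_sum _ fun j _ => measurable_const.indicator (hT j)).max measurable_const)

theorem norm_FDP_le_one {d : ℕ} (A T : Fin d → Set Ω) (ω : Ω) : ‖FDP A T ω‖ ≤ 1 := by
  have h0 : 0 ≤ ∑ j, (T j ∩ A j).indicator (fun _ => (1 : ℝ)) ω :=
    Finset.sum_nonneg fun j _ => Set.indicator_nonneg (fun _ _ => zero_le_one) _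
  have h1 : ∑ j, (T j ∩ A j).indicator (fun _ => (1 : ℝ)) ω ≤
      ∑ j, (T j).indicator (fun _ => (1 : ℝ)) ω :=
    Finset.sum_le_sum fun j _ => Set.indicator_le_indicator_of_subset Set.inter_subset_left
      (fun _ => zero_le_one) _
  rw [FDP, Real.norm_of_nonneg (by positivity)]
  exact div_le_one_of_le₀ (h1.trans (le_max_left _ _)) (by positivity)

theorem FDP_congr {d : ℕ} (A : Fin d → Set Ω) {S T : Fin d → Set Ω} {ω : Ω}
    (h : ∀ j, ω ∈ S j ↔ ω ∈ T j) : FDP A S ω = FDP A T ω := by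
  classical
  simp [FDP, Set.indicator_apply, h]

/-- **Continuity of the BFDR of CPoP in its parameter** (intermediate claim in the
proof of Proposition 2): if the law of `(P 1, …, P d)` is absolutely continuous with
respect to Lebesgue measure, then `λ ↦ BFDR(C_P(λ))` is continuous on `(0, ∞)`. -/
theorem cpop_bfdr_continuous
    {mΩ : MeasurableSpace Ω} (μ : Measure Ω) [IsProbabilityMeasure μ]
    {d : ℕ} (A : Fin d → Set Ω) (hA : ∀ j, MeasurableSet (A j))
    (P : Fin d → Ω → ℝ)
    (habs : μ.map (fun ω (j : Fin d) => P j ω) ≪ (volume : Measure (Fin d → ℝ)))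
    (𝒢 : MeasurableSpace Ω) (h𝒢 : 𝒢 ≤ mΩ)
    (hPmeas : ∀ j, Measurable[𝒢] (P j))
    (hPrange : ∀ j ω, P j ω ∈ Set.Icc (0 : ℝ) 1)
    (hPcond : ∀ j, P j =ᵐ[μ] μ[(A j).indicator (fun _ => (1 : ℝ)) | 𝒢])
    (hN : 0 < ∑ j, (μ ((A j)ᶜ)).toReal)
    (Khat : ℝ → Ω → ℕ) (C : ℝ → Fin d → Set Ω)
    (hKmeas : ∀ lam, Measurable[𝒢] (Khat lam))
    (hKle : ∀ lam ω, Khat lam ω ≤ d)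
    (hKmax : ∀ lam, 0 ≤ lam → ∀ ω, ∀ K ≤ d,
      cpopObj (∑ j, (μ ((A j)ᶜ)).toReal) lam (fun j => P j ω) K ≤
        cpopObj (∑ j, (μ ((A j)ᶜ)).toReal) lam (fun j => P j ω) (Khat lam ω))
    (hCmeas : ∀ lam j, MeasurableSet[𝒢] (C lam j))
    (hCcard : ∀ lam ω, ({j | ω ∈ C lam j} : Set (Fin d)).ncard = Khat lam ω)
    (hCsmall : ∀ lam ω j j', ω ∈ C lam j → ω ∉ C lam j' → P j ω ≤ P j' ω) :
    ContinuousOn (fun lam => BFDR μ A (C lam)) (Set.Ioi (0 : ℝ)) := by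
  intro lam₀ hlam₀
  refine ContinuousAt.continuousWithinAt ?_
  have hP : @Measurable Ω (Fin d → ℝ) mΩ _ fun ω j => P j ω :=
    @measurable_pi_lambda _ _ _ mΩ _ _ fun j => (hPmeas j).mono h𝒢 le_rfl
  have hae := ae_of_ae_map hP.aemeasurable (habs.ae_le
    (ae_injective.and (ae_cpopObj_injective (∑ j, (μ ((A j)ᶜ)).toReal) lam₀ d)))
  refine tendsto_integral_filter_of_dominated_convergence (fun _ => (1 : ℝ))
    (Filter.Eventually.of_forall fun lam =>
      (measurable_FDP hA fun j => h𝒢 _ (hCmeas lam j)).aestronglyMeasurable)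
    (Filter.Eventually.of_forall fun lam => ae_of_all _ fun ω => norm_FDP_le_one _ _ ω)
    (integrable_const _) ?_
  filter_upwards [hae] with ω hω
  have hK : ∀ᶠ lam in nhds lam₀, Khat lam ω = Khat lam₀ ω := by
    refine eventually_eq_of_forall_cpopObj_le (K := fun lam => Khat lam ω) hω.2
      (fun lam => hKle lam ω) ?_
    filter_upwards [lt_mem_nhds hlam₀] with lam hlam using hKmax lam hlam.le ω
  refine tendsto_const_nhds.congr' ?_
  filter_upwards [hK] with lam hlam
  have hC : {j | ω ∈ C lam₀ j} = {j | ω ∈ C lam j} :=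
    Set.eq_of_ncard_eq_of_forall_le hω.1 (by rw [hCcard, hCcard, hlam])
      (hCsmall lam₀ ω) (hCsmall lam ω)
  exact FDP_congr A fun j => Set.ext_iff.1 hC j
end

section
/- Null set of ties between CPoP objective values (intermediate claim in the proof of Proposition 2). Fix d ∈ ℕ, λ ≥ 0, N > 0, and integers 0 ≤ K₁ < K₂ ≤ d. For p ∈ ℝ^d let p_(1) ≤ ⋯ ≤ p_(d) be its coordinates sorted increasingly, and set f_K(p) = K − (1 − λN/max(K,1))·Σ_{j=1}^K p_(j). Then the set {p ∈ ℝ^d : f_{K₁}(p) = f_{K₂}(p)} has d-dimensional Lebesgue measure zero. -/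
open MeasureTheory

/-- A level set of a linear functional at a nonzero value is Lebesgue-null: it is either empty or
a translate of a proper subspace. -/
theorem volume_linear_level_set_eq_zero {ι : Type*} [Fintype ι] (L : (ι → ℝ) →ₗ[ℝ] ℝ)
    {b : ℝ} (hb : b ≠ 0) : volume {p : ι → ℝ | L p = b} = 0 := by
  rcases Set.eq_empty_or_nonempty {p : ι → ℝ | L p = b} with h | ⟨p₀, hp₀⟩
  · simp [h]
  · have hL : L p₀ = b := hp₀
    have hset : {p : ι → ℝ | L p = b} = (fun p => p + -p₀) ⁻¹' (LinearMap.ker L : Set (ι → ℝ)) := by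
      ext p
      simp [hL, add_neg_eq_zero]
    rw [hset, measure_preimage_add_right]
    refine Measure.addHaar_submodule _ _ fun htop => hb ?_
    rw [← hL, LinearMap.ker_eq_top.mp htop, LinearMap.zero_apply]

/-- **Null set of ties between CPoP objective values** (intermediate claim in the
proof of Proposition 2): for `K₁ < K₂ ≤ d`, the set of `p ∈ ℝ^d` on which the two
CPoP objectives `f_{K₁}` and `f_{K₂}` coincide has Lebesgue measure zero. -/
theorem cpop_tie_null_set
    (d : ℕ) (lam N : ℝ) (hlam : 0 ≤ lam) (hN : 0 < N)
    (K₁ K₂ : ℕ) (hK : K₁ < K₂) (hK₂ : K₂ ≤ d) :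
    volume {p : Fin d → ℝ |
      (K₁ : ℝ) - (1 - lam * N / max (K₁ : ℝ) 1) * sumSmallest p K₁ =
        (K₂ : ℝ) - (1 - lam * N / max (K₂ : ℝ) 1) * sumSmallest p K₂} = 0 := by
  let S (σ : Equiv.Perm (Fin d)) (K : ℕ) : (Fin d → ℝ) →ₗ[ℝ] ℝ :=
    ∑ j ∈ Finset.univ.filter (fun j : Fin d => (j : ℕ) < K), LinearMap.proj (σ j)
  let L (σ : Equiv.Perm (Fin d)) : (Fin d → ℝ) →ₗ[ℝ] ℝ :=
    (1 - lam * N / max (K₂ : ℝ) 1) • S σ K₂ - (1 - lam * N / max (K₁ : ℝ) 1) • S σ K₁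
  have hb : (K₂ : ℝ) - K₁ ≠ 0 := sub_ne_zero.mpr (by exact_mod_cast hK.ne')
  refine measure_mono_null (t := ⋃ σ, {p | L σ p = (K₂ : ℝ) - K₁}) (fun p hp => ?_)
    (measure_iUnion_null fun σ => volume_linear_level_set_eq_zero (L σ) hb)
  have hS (K : ℕ) : S (Tuple.sort p) K p = sumSmallest p K := by
    simp [S, sumSmallest, LinearMap.sum_apply]
  refine Set.mem_iUnion.mpr ⟨Tuple.sort p, ?_⟩
  simp only [Set.mem_ofPred_eq, L, LinearMap.sub_apply, LinearMap.smul_apply, hS, smul_eq_mul] at hp ⊢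
  linarith
end

section
/- FDR control of the calibrated threshold-then-verify rule (core of the proofs of Theorems 1 and 2, combining the binary p-to-e calibrator with the eBH guarantee). Let (Ω, ℱ, μ) be a probability space, d ∈ ℕ, H₀ ⊆ {1,…,d}, and let p_1, …, p_d : Ω → [0,1] be measurable. Assume each null p-value is super-uniform: for every j ∈ H₀ and every s ∈ [0,1], μ(p_j ≤ s) ≤ s. Fix q ∈ (0,1], α ∈ (0,1), and a real m ≥ #H₀. Define r(ω) = #{j : p_j(ω) ≤ q} and the rejection set R(ω) = {j : p_j(ω) ≤ q} if q·m ≤ α·r(ω), and R(ω) = ∅ otherwise. Then E[ #(R ∩ H₀) / max(#R, 1) ] ≤ α. -/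
open MeasureTheory

variable {Ω : Type*}

/-- The rejection set of the calibrated threshold-then-verify rule: reject
`{j : p j ω ≤ q}` if `q·m ≤ α·#{j : p j ω ≤ q}`, and reject nothing otherwise. -/
noncomputable def thresholdRejections {d : ℕ} (p : Fin d → Ω → ℝ)
    (q α m : ℝ) (ω : Ω) : Finset (Fin d) :=
  if q * m ≤ α * ((Finset.univ.filter (fun j : Fin d => p j ω ≤ q)).card : ℝ) then
    Finset.univ.filter (fun j : Fin d => p j ω ≤ q)
  else ∅

/-- The false discovery proportion is at most `α` times the average over the `m` nominal nulls
of the binary e-values `1{p j ≤ q} / q`. -/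
lemma thresholdRejections_fdp_le {d : ℕ} (H0 : Finset (Fin d)) (p : Fin d → Ω → ℝ)
    {q α m : ℝ} (hq : 0 < q) (hα : 0 < α) (hm : 0 < m) (ω : Ω) :
    ((thresholdRejections p q α m ω ∩ H0).card : ℝ) /
        max ((thresholdRejections p q α m ω).card : ℝ) 1 ≤
      α / (q * m) * ∑ j ∈ H0, {ω | p j ω ≤ q}.indicator (fun _ => (1 : ℝ)) ω := by
  have hsum : ∑ j ∈ H0, {ω | p j ω ≤ q}.indicator (fun _ => (1 : ℝ)) ω =
      ((Finset.univ.filter (fun j : Fin d => p j ω ≤ q) ∩ H0).card : ℝ) := by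
    rw [Finset.filter_inter, Finset.univ_inter, Finset.card_filter]
    simp [Set.indicator_apply]
  have hqm : 0 < q * m := mul_pos hq hm
  rw [hsum]
  unfold thresholdRejections
  split_ifs with h
  · have hr := pos_of_mul_pos_right (hqm.trans_le h) hα.le
    rw [div_mul_eq_mul_div, div_le_div_iff₀ (by positivity) hqm]
    calc _ ≤ _ := mul_le_mul_of_nonneg_left
          (h.trans (mul_le_mul_of_nonneg_left (le_max_left _ 1) hα.le)) (Nat.cast_nonneg _)
      _ = _ := by ring
  · rw [Finset.empty_inter, Finset.card_empty, Nat.cast_zero, zero_div]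
    positivity

/-- **FDR control of the calibrated threshold-then-verify rule** (core of the proofs
of Theorems 1 and 2; this is the eBH procedure applied to the binary e-values
`e_j = 1{p_j ≤ q}/q` with null-count input `m ≥ #H₀`). -/
theorem threshold_then_verify_fdr_control
    {mΩ : MeasurableSpace Ω} (μ : Measure Ω) [IsProbabilityMeasure μ]
    {d : ℕ} (H0 : Finset (Fin d))
    (p : Fin d → Ω → ℝ)
    (hpmeas : ∀ j, Measurable (p j)) (hprange : ∀ j ω, p j ω ∈ Set.Icc (0 : ℝ) 1)
    (hsuper : ∀ j ∈ H0, ∀ s ∈ Set.Icc (0 : ℝ) 1, (μ {ω | p j ω ≤ s}).toReal ≤ s)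
    (q : ℝ) (hq : q ∈ Set.Ioc (0 : ℝ) 1) (α : ℝ) (hα : α ∈ Set.Ioo (0 : ℝ) 1)
    (m : ℝ) (hm : (H0.card : ℝ) ≤ m) :
    ∫ ω, (((thresholdRejections p q α m ω ∩ H0).card : ℝ)) /
        max ((thresholdRejections p q α m ω).card : ℝ) 1 ∂μ ≤ α := by
  obtain ⟨hq0, hq1⟩ := hq
  obtain ⟨hα0, -⟩ := hα
  rcases H0.eq_empty_or_nonempty with rfl | hne
  · simpa using hα0.le
  have hm0 : 0 < m := lt_of_lt_of_le (by exact_mod_cast hne.card_pos) hm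
  have hset : ∀ j, MeasurableSet {ω | p j ω ≤ q} := fun j =>
    measurableSet_le (hpmeas j) measurable_const
  have hint : ∀ j ∈ H0, Integrable ({ω | p j ω ≤ q}.indicator (fun _ => (1 : ℝ))) μ :=
    fun j _ => (integrable_const 1).indicator (hset j)
  calc
    _ ≤ ∫ ω, α / (q * m) * ∑ j ∈ H0, {ω | p j ω ≤ q}.indicator (fun _ => (1 : ℝ)) ω ∂μ :=
      integral_mono_of_nonneg (.of_forall fun ω => by positivity)
        ((integrable_finsetSum H0 hint).const_mul _)
        (.of_forall (thresholdRejections_fdp_le H0 p hq0 hα0 hm0))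
    _ = α / (q * m) * ∑ j ∈ H0, (μ {ω | p j ω ≤ q}).toReal := by
      rw [integral_const_mul, integral_finsetSum H0 hint]
      simp [integral_indicator_const _ (hset _), Measure.real]
    _ ≤ α / (q * m) * (m * q) := by
      gcongr
      calc _ ≤ ∑ _j ∈ H0, q := Finset.sum_le_sum fun j hj => hsuper j hj q ⟨hq0.le, hq1⟩
        _ ≤ m * q := by
          rw [Finset.sum_const, nsmul_eq_mul]
          gcongr
    _ = α := by field_simp
end
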